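/- Uniform bound for the two-singularity integral: Suppose 0 < ε < 1/8 and for e ∈ ℝ set F(e) = ∫_ℝ du / ( |u−e|^{8ε} ⟨u⟩^{1−4ε} ). Then there is a constant C (depending only on ε) such that F(e) ≤ C for every e ∈ ℝ. -/

import Mathlib

open MeasureTheory
open scoped ENNReal

noncomputable section

/-- Japanese bracket `⟨x⟩ = √(1+x²)`. -/
def jap (x : ℝ) : ℝ := Real.sqrt (1 + x ^ 2)

/-- The two-singularity integral `F(e) = ∫ du / (|u-e|^{8ε} ⟨u⟩^{1-4ε})`, valued in `[0,∞]`. -/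
def Fint (ε e : ℝ) : ℝ≥0∞ :=
  ∫⁻ u : ℝ, (ENNReal.ofReal (|u - e| ^ (8*ε) * jap u ^ (1 - 4*ε)))⁻¹

/-- Half of `1 + |x|` is a lower bound for the Japanese bracket. -/
lemma half_one_add_abs_le_jap (x : ℝ) : (1 + |x|) / 2 ≤ jap x := by
  refine Real.le_sqrt_of_sq_le ?_
  nlinarith [sq_nonneg (1 - |x|), sq_abs x]

lemma one_le_jap (x : ℝ) : 1 ≤ jap x :=
  Real.one_le_sqrt.2 (by nlinarith [sq_nonneg x])

lemma inv_rpow_mul_rpow_le {a b p q t : ℝ} (ha : 0 ≤ a) (hb : 0 ≤ b) (ht : 0 < t)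
    (hp : t / 2 ≤ p) (hq : t / 2 ≤ q) :
    (p ^ a * q ^ b)⁻¹ ≤ 2 ^ (a + b) * t ^ (-(a + b)) := by
  have h2 : 0 < t / 2 := half_pos ht
  have hp₀ : 0 ≤ p := h2.le.trans hp
  have h : (t / 2) ^ (a + b) ≤ p ^ a * q ^ b := by
    rw [Real.rpow_add h2]
    gcongr
  calc (p ^ a * q ^ b)⁻¹ ≤ ((t / 2) ^ (a + b))⁻¹ := by gcongr
    _ = 2 ^ (a + b) * t ^ (-(a + b)) := by
      rw [Real.div_rpow ht.le zero_le_two, inv_div, Real.rpow_neg ht.le, div_eq_mul_inv]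

/-- The power `v ^ (-a)` cut off to the unit interval. -/
def unitPow (a : ℝ) : ℝ → ℝ := (Set.Ioo 0 1).indicator fun v => v ^ (-a)

lemma unitPow_nonneg (a v : ℝ) : 0 ≤ unitPow a v :=
  Set.indicator_nonneg (fun _ hx => Real.rpow_nonneg hx.1.le _) v

lemma integrable_unitPow {a : ℝ} (ha : a < 1) : Integrable (unitPow a) :=
  ((intervalIntegral.integrableOn_Ioo_rpow_iff one_pos).2 (by linarith)).integrable_indicator
    measurableSet_Ioo

lemma abs_rpow_neg_le_unitPow_add {a v : ℝ} (hv : v ≠ 0) (hv1 : |v| < 1) :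
    |v| ^ (-a) ≤ unitPow a v + unitPow a (-v) := by
  have hmem : |v| ∈ Set.Ioo (0 : ℝ) 1 := ⟨abs_pos.2 hv, hv1⟩
  have h : |v| ^ (-a) = unitPow a |v| :=
    (Set.indicator_of_mem hmem fun v : ℝ => v ^ (-a)).symm
  have h₁ := unitPow_nonneg a v
  have h₂ := unitPow_nonneg a (-v)
  rw [h]
  rcases abs_choice v with hc | hc <;> rw [hc] <;> linarith

/-- Either `u` or `v` controls the product of the two singular weights, up to the local
singularity at `v = 0`. -/
lemma inv_abs_rpow_mul_jap_rpow_le {a b u v : ℝ} (ha : 0 ≤ a) (hb : 0 ≤ b) (hv : v ≠ 0) :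
    (|v| ^ a * jap u ^ b)⁻¹ ≤ 2 ^ (a + b) * (1 + ‖u‖) ^ (-(a + b)) +
      2 ^ (a + b) * (1 + ‖v‖) ^ (-(a + b)) + (unitPow a v + unitPow a (-v)) := by
  have hu₀ : 0 ≤ 2 ^ (a + b) * (1 + ‖u‖) ^ (-(a + b)) := by positivity
  have hv₀ : 0 ≤ 2 ^ (a + b) * (1 + ‖v‖) ^ (-(a + b)) := by positivity
  have h₁ := unitPow_nonneg a v
  have h₂ := unitPow_nonneg a (-v)
  have hju := half_one_add_abs_le_jap u
  have hvpos : 0 < |v| := abs_pos.2 hv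
  rcases lt_or_ge |v| 1 with hv1 | hv1
  · have h : (|v| ^ a * jap u ^ b)⁻¹ ≤ |v| ^ (-a) := by
      rw [Real.rpow_neg hvpos.le]
      gcongr
      exact le_mul_of_one_le_right (by positivity) (Real.one_le_rpow (one_le_jap u) hb)
    linarith [abs_rpow_neg_le_unitPow_add (a := a) hv hv1]
  · rcases le_total |v| (jap u) with hle | hle
    · have := inv_rpow_mul_rpow_le (t := 1 + ‖v‖) (p := |v|) (q := jap u) ha hb (by positivity)
        (by rw [Real.norm_eq_abs]; linarith) (by rw [Real.norm_eq_abs]; linarith)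
      linarith
    · have := inv_rpow_mul_rpow_le (t := 1 + ‖u‖) (p := |v|) (q := jap u) ha hb (by positivity)
        (hju.trans hle) hju
      linarith

lemma exists_lintegral_inv_abs_rpow_mul_jap_rpow_le {a b : ℝ} (ha : 0 ≤ a) (ha1 : a < 1)
    (hb : 0 ≤ b) (hab : 1 < a + b) :
    ∃ C : ℝ, ∀ e : ℝ,
      ∫⁻ u : ℝ, (ENNReal.ofReal (|u - e| ^ a * jap u ^ b))⁻¹ ≤ ENNReal.ofReal C := by
  set G : ℝ → ℝ := fun x => 2 ^ (a + b) * (1 + ‖x‖) ^ (-(a + b))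
  have hG₀ (x : ℝ) : 0 ≤ G x := by positivity
  have hG : Integrable G := (integrable_one_add_norm (by simpa using hab)).const_mul _
  have hL := integrable_unitPow ha1
  set H : ℝ → ℝ := fun v => G v + (unitPow a v + unitPow a (-v))
  have hH : Integrable H := hG.add (hL.add hL.comp_neg)
  have hH₀ (v : ℝ) : 0 ≤ H v :=
    add_nonneg (hG₀ v) (add_nonneg (unitPow_nonneg a v) (unitPow_nonneg a (-v)))
  refine ⟨(∫ u, G u) + ∫ v, H v, fun e => ?_⟩
  have hHe : Integrable fun u => H (u - e) := hH.comp_sub_right e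
  have hGH : Integrable fun u => G u + H (u - e) := hG.add hHe
  rw [← integral_sub_right_eq_self H e, ← integral_add hG hHe,
    ofReal_integral_eq_lintegral_ofReal hGH
      (Filter.Eventually.of_forall fun u => add_nonneg (hG₀ u) (hH₀ (u - e)))]
  refine lintegral_mono_ae ?_
  filter_upwards [Measure.ae_ne volume e] with u hu
  have hv : u - e ≠ 0 := sub_ne_zero.2 hu
  have hpos : 0 < |u - e| ^ a * jap u ^ b :=
    mul_pos (Real.rpow_pos_of_pos (abs_pos.2 hv) _)
      (Real.rpow_pos_of_pos (one_pos.trans_le (one_le_jap u)) _)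
  rw [← ENNReal.ofReal_inv_of_pos hpos]
  refine ENNReal.ofReal_le_ofReal ((inv_abs_rpow_mul_jap_rpow_le ha hb hv).trans_eq ?_)
  simp only [G, H, add_assoc]

/-- **Uniform bound for the two-singularity integral**: for `0 < ε < 1/8`,
`F(e)` is bounded uniformly in `e`. -/
theorem two_singularity_integral_bound (ε : ℝ) (hε0 : 0 < ε) (hε : ε < 1/8) :
    ∃ C : ℝ, ∀ e : ℝ, Fint ε e ≤ ENNReal.ofReal C := by
  exact exists_lintegral_inv_abs_rpow_mul_jap_rpow_le (by linarith) (by linarith) (by linarith)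
    (by linarith)

end
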